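/- Let c be the unique positive real number with ∫₀^c (e^x − 1)/x dx = 1, and let w : (0,1) → ℝ be defined by w(t) = −e^{−c} + (e^{−ct} − e^{−ct/(1−t)})/t + (e^{−ct} − t·e^{−c})/(1−t) + (c/(1−t))·[I(c/(1−t), c) − I(ct/(1−t), ct)], where I(t,s) = ∫_s^t e^{−ξ}/ξ dξ. Then ∫₀¹ w(t) dt = e^{−c} + (e^{c} − c − 1)·∫₁^∞ e^{−cx}/x dx. -/

import Mathlib

/-- `I(t,s) = ∫_s^t e^{−ξ}/ξ dξ`. -/
noncomputable def Ifun (t s : ℝ) : ℝ := ∫ ξ in s..t, Real.exp (-ξ) / ξ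

/-- The asymptotic winning rate `w` of the full-information best choice problem. -/
noncomputable def winRate (c t : ℝ) : ℝ :=
  -Real.exp (-c) + (Real.exp (-c * t) - Real.exp (-c * t / (1 - t))) / t
    + (Real.exp (-c * t) - t * Real.exp (-c)) / (1 - t)
    + (c / (1 - t)) * (Ifun (c / (1 - t)) c - Ifun (c * t / (1 - t)) (c * t))

section helpers
open Real Set Filter Topology MeasureTheory intervalIntegral
open scoped Interval

noncomputable def EE (x : ℝ) : ℝ := ∫ ξ in Ioi x, Real.exp (-ξ) / ξ

noncomputable def KK (a : ℝ) : ℝ := ∫ x in (0:ℝ)..a, (Real.exp x - 1) / x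

lemma EE_int {x : ℝ} (hx : 0 < x) : IntegrableOn (fun ξ => Real.exp (-ξ) / ξ) (Ioi x) := by
  have h1 : IntegrableOn (fun ξ => Real.exp (-ξ) / x) (Ioi x) := by
    have := (exp_neg_integrableOn_Ioi x (b := 1) one_pos).div_const x
    simpa [IntegrableOn] using this
  refine Integrable.mono' h1 ?_ ?_
  · exact (Measurable.aestronglyMeasurable (by fun_prop))
  · refine (ae_restrict_iff' measurableSet_Ioi).2 (Eventually.of_forall fun ξ hξ => ?_)
    have hξ' : x < ξ := hξ
    have : 0 < ξ := hx.trans hξ'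
    rw [Real.norm_of_nonneg (by positivity)]
    gcongr

lemma EE_sub {x y : ℝ} (hx : 0 < x) (hy : 0 < y) :
    EE x - EE y = ∫ ξ in x..y, Real.exp (-ξ) / ξ :=
  integral_Ioi_sub_Ioi' (EE_int hx) (EE_int hy)

lemma Ifun_eq {x y : ℝ} (hx : 0 < x) (hy : 0 < y) : Ifun y x = EE x - EE y :=
  (EE_sub hx hy).symm

lemma EE_nonneg {x : ℝ} (hx : 0 < x) : 0 ≤ EE x :=
  setIntegral_nonneg measurableSet_Ioi fun ξ hξ => by
    have : 0 < ξ := hx.trans hξ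
    positivity

lemma EE_le {x : ℝ} (hx : 0 < x) : EE x ≤ Real.exp (-x) / x := by
  have h1 : IntegrableOn (fun ξ => Real.exp (-ξ) / x) (Ioi x) := by
    have := (exp_neg_integrableOn_Ioi x (b := 1) one_pos).div_const x
    simpa [IntegrableOn] using this
  have : EE x ≤ ∫ ξ in Ioi x, Real.exp (-ξ) / x := by
    refine setIntegral_mono_on (EE_int hx) h1 measurableSet_Ioi fun ξ hξ => ?_
    have hξ' : x < ξ := hξ
    have : 0 < ξ := hx.trans hξ'
    gcongr
  rwa [MeasureTheory.integral_div, integral_exp_neg_Ioi] at this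

lemma intint {x y : ℝ} (hx : 0 < x) (hy : 0 < y) :
    IntervalIntegrable (fun ξ => Real.exp (-ξ) / ξ) volume x y := by
  refine ContinuousOn.intervalIntegrable ?_
  refine ContinuousOn.div (by fun_prop) (by fun_prop) fun z hz => ?_
  have := (lt_min hx hy).trans_le hz.1
  exact this.ne'

lemma EE_deriv {x : ℝ} (hx : 0 < x) : HasDerivAt EE (-(Real.exp (-x) / x)) x := by
  have h1 : HasDerivAt (fun u => ∫ ξ in (1:ℝ)..u, Real.exp (-ξ) / ξ) (Real.exp (-x) / x) x := by
    refine integral_hasDerivAt_right (f := fun ξ => Real.exp (-ξ) / ξ) (intint one_pos hx) ?_ ?_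
    · exact Measurable.stronglyMeasurable (by fun_prop) |>.stronglyMeasurableAtFilter
    · exact ContinuousAt.div (by fun_prop) (by fun_prop) hx.ne'
  have h2 := h1.const_sub (EE 1)
  refine h2.congr_of_eventuallyEq ?_
  filter_upwards [lt_mem_nhds hx] with y hy
  rw [← EE_sub one_pos hy]; ring

lemma EE_diff_nonneg {x y : ℝ} (hx : 0 < x) (hxy : x ≤ y) : 0 ≤ EE x - EE y := by
  rw [EE_sub hx (hx.trans_le hxy)]
  refine integral_nonneg hxy fun u hu => ?_
  have := hx.trans_le hu.1
  positivity

lemma EE_diff_le {x y : ℝ} (hx : 0 < x) (hxy : x ≤ y) :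
    EE x - EE y ≤ (y - x) * (Real.exp (-x) / x) := by
  rw [EE_sub hx (hx.trans_le hxy)]
  have : ∫ ξ in x..y, Real.exp (-ξ) / ξ ≤ ∫ ξ in x..y, Real.exp (-x) / x := by
    refine integral_mono_on hxy (intint hx (hx.trans_le hxy)) (by simp) fun u hu => ?_
    have := hx.trans_le hu.1
    have := hu.1
    gcongr
  simpa [mul_div_assoc] using this

lemma EE_tendsto : Tendsto EE atTop (𝓝 0) := by
  have h : Tendsto (fun x : ℝ => Real.exp (-x) / x) atTop (𝓝 0) :=
    Real.tendsto_exp_neg_atTop_nhds_zero.div_atTop tendsto_id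
  refine tendsto_of_tendsto_of_tendsto_of_le_of_le' tendsto_const_nhds h ?_ ?_
  · filter_upwards [eventually_gt_atTop 0] with x hx using EE_nonneg hx
  · filter_upwards [eventually_gt_atTop 0] with x hx using EE_le hx

lemma EE_scale {c : ℝ} (hc : 0 < c) :
    ∫ x in Set.Ioi (1:ℝ), Real.exp (-c * x) / x = EE c := by
  have := integral_comp_mul_left_Ioi' (fun ξ => Real.exp (-ξ) / ξ) 1 hc
  rw [mul_one] at this
  rw [EE, ← this, smul_eq_mul, ← MeasureTheory.integral_const_mul]
  refine setIntegral_congr_fun measurableSet_Ioi fun x hx => ?_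
  have : (0:ℝ) < x := one_pos.trans hx
  rw [neg_mul]
  field_simp

lemma EE_cont : ContinuousOn EE (Ioi 0) := fun _ hx =>
  (EE_deriv hx).continuousAt.continuousWithinAt

lemma meas_of_cont {f : ℝ → ℝ} {b : ℝ} (hb : 0 ≤ b) (hf : ContinuousOn f (Ioo 0 b)) :
    AEStronglyMeasurable f (volume.restrict (Ι 0 b)) := by
  rw [uIoc_of_le hb, ← restrict_Ioo_eq_restrict_Ioc]
  exact hf.aestronglyMeasurable measurableSet_Ioo

lemma ae_Ioo {P : ℝ → Prop} {b : ℝ} (hb : 0 ≤ b) (h : ∀ t ∈ Ioo 0 b, P t) :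
    ∀ᵐ t ∂(volume : Measure ℝ), t ∈ Ι 0 b → P t := by
  have : ∀ᵐ t ∂(volume : Measure ℝ), t ≠ b := by simp [ae_iff, measure_singleton]
  filter_upwards [this] with t ht h2
  rw [uIoc_of_le hb] at h2
  exact h t ⟨h2.1, lt_of_le_of_ne h2.2 ht⟩

lemma bint {f : ℝ → ℝ} {b C : ℝ} (hb : 0 ≤ b) (hf : ContinuousOn f (Ioo 0 b))
    (h : ∀ t ∈ Ioo 0 b, |f t| ≤ C) : IntervalIntegrable f volume 0 b := by
  refine IntervalIntegrable.mono_fun' (g := fun _ => C) (by simp) (meas_of_cont hb hf) ?_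
  exact (ae_restrict_iff' measurableSet_uIoc).2 (ae_Ioo hb h)

lemma exp_sub_one_bound {x a : ℝ} (hx : 0 < x) (hxa : x ≤ a) :
    0 ≤ (Real.exp x - 1) / x ∧ (Real.exp x - 1) / x ≤ Real.exp x := by
  constructor
  · have := Real.add_one_le_exp x
    apply div_nonneg <;> linarith
  · rw [div_le_iff₀ hx]
    have := Real.add_one_le_exp (-x)
    have h2 : Real.exp x * Real.exp (-x) = 1 := by rw [← Real.exp_add]; simp
    nlinarith [Real.exp_pos x]

lemma KK_int {a : ℝ} (ha : 0 ≤ a) :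
    IntervalIntegrable (fun x => (Real.exp x - 1) / x) volume 0 a := by
  refine bint (C := Real.exp a) ha ?_ fun t ht => ?_
  · exact ContinuousOn.div (by fun_prop) (by fun_prop) fun z hz => hz.1.ne'
  · obtain ⟨h1, h2⟩ := exp_sub_one_bound ht.1 ht.2.le
    rw [abs_of_nonneg h1]
    exact h2.trans (Real.exp_le_exp.2 ht.2.le)

lemma KK_deriv {a : ℝ} (ha : 0 < a) : HasDerivAt KK ((Real.exp a - 1) / a) a := by
  refine integral_hasDerivAt_right (f := fun x => (Real.exp x - 1) / x) (KK_int ha.le) ?_ ?_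
  · exact Measurable.stronglyMeasurable (by fun_prop) |>.stronglyMeasurableAtFilter
  · exact ContinuousAt.div (by fun_prop) (by fun_prop) ha.ne'

lemma KK_bound {a : ℝ} (ha : 0 < a) : 0 ≤ KK a ∧ KK a ≤ Real.exp a := by
  constructor
  · refine integral_nonneg ha.le fun u hu => ?_
    rcases hu.1.eq_or_lt with h | h
    · simp [← h]
    · exact (exp_sub_one_bound h hu.2).1
  · have : KK a ≤ ∫ x in (0:ℝ)..a, Real.exp x := by
      refine integral_mono_on_of_le_Ioo ha.le (KK_int ha.le) (by simp) fun u hu => ?_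
      exact (exp_sub_one_bound hu.1 hu.2.le).2
    rw [integral_exp] at this
    simp at this
    linarith

/-- integral of the third kind of term -/
lemma T3 {a : ℝ} (ha : 0 < a) :
    ∫ t in (0:ℝ)..1, (Real.exp (-a * t) - Real.exp (-a)) / (1 - t) = Real.exp (-a) * KK a := by
  have h1 := intervalIntegral.integral_comp_sub_left (a := 0) (b := 1)
    (fun s => Real.exp (-a) * ((Real.exp (a * s) - 1) / s)) 1
  have h2 := intervalIntegral.mul_integral_comp_mul_left (a := 0) (b := 1)
    (f := fun x => (Real.exp x - 1) / x) a
  simp only [sub_self, sub_zero, mul_zero, mul_one] at h1 h2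
  rw [KK, ← h2, ← intervalIntegral.integral_const_mul, ← intervalIntegral.integral_const_mul]
  have h3 : ∀ s : ℝ, Real.exp (-a) * (a * ((Real.exp (a * s) - 1) / (a * s)))
     = Real.exp (-a) * ((Real.exp (a * s) - 1) / s) := by
    intro s
    rw [← mul_div_assoc, mul_div_mul_left _ _ ha.ne']
  simp only [h3]
  rw [← h1]
  congr 1
  ext t
  rw [← mul_div_assoc, mul_sub, ← Real.exp_add]
  congr 2 <;> ring_nf

noncomputable def VV (a t : ℝ) : ℝ :=
  (EE (a * t) - EE (a * t / (1 - t)) - EE a + EE (a / (1 - t))) / (1 - t)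

noncomputable def VD (a t : ℝ) : ℝ :=
  (-((Real.exp (-a * t) - Real.exp (-a)) / (1 - t))
    + (Real.exp a - 1) * (Real.exp (-(a / (1 - t))) / (1 - t))) / a

lemma exp_split {a t : ℝ} (ht : t < 1) :
    Real.exp (-(a * t / (1 - t))) = Real.exp a * Real.exp (-(a / (1 - t))) := by
  have : 1 - t ≠ 0 := by linarith
  rw [← Real.exp_add]
  congr 1
  field_simp
  ring

lemma cont_E1 {a : ℝ} (ha : 0 < a) : ContinuousOn (fun t => EE (a * t)) (Ioo 0 1) :=
  EE_cont.comp (by fun_prop) fun t ht => mul_pos ha ht.1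

lemma cont_E2 {a : ℝ} (ha : 0 < a) : ContinuousOn (fun t => EE (a * t / (1 - t))) (Ioo 0 1) :=
  EE_cont.comp (ContinuousOn.div (by fun_prop) (by fun_prop) fun t ht => (sub_pos.2 ht.2).ne')
    fun t ht => div_pos (mul_pos ha ht.1) (sub_pos.2 ht.2)

lemma cont_E3 {a : ℝ} (ha : 0 < a) : ContinuousOn (fun t => EE (a / (1 - t))) (Ioo 0 1) :=
  EE_cont.comp (ContinuousOn.div (by fun_prop) (by fun_prop) fun t ht => (sub_pos.2 ht.2).ne')
    fun t ht => div_pos ha (sub_pos.2 ht.2)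

lemma VV_cont {a : ℝ} (ha : 0 < a) : ContinuousOn (VV a) (Ioo 0 1) :=
  ContinuousOn.div ((((cont_E1 ha).sub (cont_E2 ha)).sub continuousOn_const).add (cont_E3 ha))
    (by fun_prop) fun t ht => (sub_pos.2 ht.2).ne'

lemma VV_bound1 {a t : ℝ} (ha : 0 < a) (ht : t ∈ Ioo (0:ℝ) 1) :
    |VV a t| ≤ Real.exp (-(a * t)) / t := by
  obtain ⟨h0, h1⟩ := ht
  have hs : 0 < 1 - t := by linarith
  have hat : 0 < a * t := by positivity
  have hle : a * t ≤ a := by nlinarith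
  have A1 := EE_diff_nonneg hat hle
  have A2 := EE_diff_le hat hle
  have hat' : 0 < a * t / (1 - t) := by positivity
  have hle' : a * t / (1 - t) ≤ a / (1 - t) := by gcongr
  have B1 := EE_diff_nonneg hat' hle'
  have B2 := EE_diff_le hat' hle'
  have e1 : (a - a * t) * (Real.exp (-(a * t)) / (a * t))
      = Real.exp (-(a * t)) / t * (1 - t) := by
    field_simp
  have e2 : (a / (1 - t) - a * t / (1 - t)) * (Real.exp (-(a * t / (1 - t))) / (a * t / (1 - t)))
      = Real.exp (-(a * t / (1 - t))) / t * (1 - t) := by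
    field_simp
  have e3 : Real.exp (-(a * t / (1 - t))) / t * (1 - t) ≤ Real.exp (-(a * t)) / t * (1 - t) := by
    have : a * t ≤ a * t / (1 - t) := by
      rw [le_div_iff₀ hs]; nlinarith
    gcongr
  rw [VV, abs_div, abs_of_pos hs, div_le_iff₀ hs, abs_le]
  constructor <;> linarith

lemma VV_bound {a t : ℝ} (ha : 0 < a) (ht : t ∈ Ioo (0:ℝ) 1) : |VV a t| ≤ 2 := by
  have hb1 := VV_bound1 ha ht
  obtain ⟨h0, h1⟩ := ht
  have hs : 0 < 1 - t := by linarith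
  have hat : 0 < a * t := by positivity
  rcases le_total t (1/2) with h | h
  · have hle : a * t ≤ a * t / (1 - t) := by
      rw [le_div_iff₀ hs]; nlinarith
    have hle' : a ≤ a / (1 - t) := by
      rw [le_div_iff₀ hs]; nlinarith
    have A1 := EE_diff_nonneg hat hle
    have A2 := EE_diff_le hat hle
    have B1 := EE_diff_nonneg ha hle'
    have B2 := EE_diff_le ha hle'
    have key : ∀ x : ℝ, 0 < x → (x / (1 - t) - x) * (Real.exp (-x) / x) ≤ 1 := by
      intro x hx
      have e : (x / (1 - t) - x) * (Real.exp (-x) / x) = t / (1 - t) * Real.exp (-x) := by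
        field_simp
        ring
      rw [e]
      have : t / (1 - t) ≤ 1 := by rw [div_le_one hs]; linarith
      have h3 : Real.exp (-x) ≤ 1 := Real.exp_le_one_iff.2 (by linarith)
      exact mul_le_one₀ this (Real.exp_pos _).le h3
    have A3 := key _ hat
    have B3 := key _ ha
    rw [VV, abs_div, abs_of_pos hs, div_le_iff₀ hs, abs_le]
    constructor <;> linarith
  · refine hb1.trans ?_
    rw [div_le_iff₀ h0]
    have h3 : Real.exp (-(a * t)) ≤ 1 := Real.exp_le_one_iff.2 (by linarith)
    linarith

lemma VV_int {a : ℝ} (ha : 0 < a) : IntervalIntegrable (VV a) volume 0 1 :=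
  bint zero_le_one (VV_cont ha) fun _ ht => VV_bound ha ht

lemma VV_deriv {a t : ℝ} (ha : 0 < a) (ht : t ∈ Ioo (0:ℝ) 1) :
    HasDerivAt (fun x => VV x t) (VD a t) a := by
  obtain ⟨h0, h1⟩ := ht
  have hs : 0 < 1 - t := by linarith
  have d1 : HasDerivAt (fun x : ℝ => x * t) t a := by simpa using (hasDerivAt_id a).mul_const t
  have d2 : HasDerivAt (fun x : ℝ => x * t / (1 - t)) (t / (1 - t)) a := d1.div_const _
  have d3 : HasDerivAt (fun x : ℝ => x / (1 - t)) (1 / (1 - t)) a := (hasDerivAt_id a).div_const _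
  have E1 := (EE_deriv (x := a * t) (by positivity)).comp a d1
  have E2 := (EE_deriv (x := a * t / (1 - t)) (by positivity)).comp a d2
  have E3 := (EE_deriv (x := a / (1 - t)) (by positivity)).comp a d3
  have E4 := EE_deriv ha
  have := (((E1.sub E2).sub E4).add E3).div_const (1 - t)
  refine this.congr_deriv ?_
  rw [VD, exp_split h1, neg_mul]
  field_simp
  ring

lemma third_bound {a t : ℝ} (ha : 0 < a) (ht : t ∈ Ioo (0:ℝ) 1) :
    |(Real.exp (-a * t) - Real.exp (-a)) / (1 - t)| ≤ a := by
  obtain ⟨h0, h1⟩ := ht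
  have hs : 0 < 1 - t := by linarith
  have h2 : Real.exp (-a) ≤ Real.exp (-a * t) := Real.exp_le_exp.2 (by nlinarith)
  rw [abs_of_nonneg (div_nonneg (by linarith) hs.le), div_le_iff₀ hs]
  have h3 := Real.add_one_le_exp (-(a * (1 - t)))
  have h4 : Real.exp (-a * t) * Real.exp (-(a * (1 - t))) = Real.exp (-a) := by
    rw [← Real.exp_add]; congr 1; ring
  have h5 : Real.exp (-a * t) ≤ 1 := Real.exp_le_one_iff.2 (by nlinarith)
  have h6 : 0 < a * (1 - t) := by positivity
  nlinarith [Real.exp_pos (-a * t)]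

lemma fourth_bound {a t : ℝ} (ha : 0 < a) (ht : t ∈ Ioo (0:ℝ) 1) :
    |Real.exp (-(a / (1 - t))) / (1 - t)| ≤ 1 / a := by
  obtain ⟨h0, h1⟩ := ht
  have hs : 0 < 1 - t := by linarith
  rw [abs_of_nonneg (by positivity), div_le_iff₀ hs]
  have h3 := Real.add_one_le_exp (a / (1 - t))
  have h4 : 0 < a / (1 - t) := by positivity
  rw [Real.exp_neg]
  have : (Real.exp (a / (1 - t)))⁻¹ ≤ (a / (1 - t))⁻¹ := by
    gcongr; linarith
  refine this.trans_eq ?_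
  field_simp

lemma third_cont (a : ℝ) :
    ContinuousOn (fun t => (Real.exp (-a * t) - Real.exp (-a)) / (1 - t)) (Ioo 0 1) :=
  ContinuousOn.div (by fun_prop) (by fun_prop) fun t ht => (sub_pos.2 ht.2).ne'

lemma fourth_cont (a : ℝ) :
    ContinuousOn (fun t => Real.exp (-(a / (1 - t))) / (1 - t)) (Ioo 0 1) := by
  have : ContinuousOn (fun t : ℝ => a / (1 - t)) (Ioo 0 1) :=
    ContinuousOn.div (by fun_prop) (by fun_prop) fun t ht => (sub_pos.2 ht.2).ne'
  exact ContinuousOn.div (by fun_prop) (by fun_prop) fun t ht => (sub_pos.2 ht.2).ne'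

lemma third_int {a : ℝ} (ha : 0 < a) : IntervalIntegrable
    (fun t => (Real.exp (-a * t) - Real.exp (-a)) / (1 - t)) volume 0 1 :=
  bint zero_le_one (third_cont a) fun _ ht => third_bound ha ht

lemma fourth_int {a : ℝ} (ha : 0 < a) : IntervalIntegrable
    (fun t => Real.exp (-(a / (1 - t))) / (1 - t)) volume 0 1 :=
  bint zero_le_one (fourth_cont a) fun _ ht => fourth_bound ha ht

lemma tendsto_inv_left : Tendsto (fun t : ℝ => (1 - t)⁻¹) (𝓝[<] 1) atTop := by
  refine tendsto_inv_nhdsGT_zero.comp ?_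
  refine tendsto_nhdsWithin_iff.2 ⟨?_, ?_⟩
  · have : Tendsto (fun t : ℝ => 1 - t) (𝓝 1) (𝓝 (1 - 1)) := by
      exact (continuous_const.sub continuous_id).tendsto 1
    rw [sub_self] at this
    exact this.mono_left nhdsWithin_le_nhds
  · filter_upwards [self_mem_nhdsWithin] with t ht
    exact sub_pos.2 (mem_Iio.1 ht)

lemma E3_left {a : ℝ} (ha : 0 < a) :
    Tendsto (fun t => EE (a / (1 - t))) (𝓝[<] 1) (𝓝 0) := by
  refine EE_tendsto.comp ?_
  exact tendsto_inv_left.const_mul_atTop ha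

lemma E3_right {a : ℝ} (ha : 0 < a) :
    Tendsto (fun t => EE (a / (1 - t))) (𝓝[>] 0) (𝓝 (EE a)) := by
  have h : ContinuousAt (fun t : ℝ => EE (a / (1 - t))) 0 := by
    refine ContinuousAt.comp (g := EE) (f := fun t : ℝ => a / (1 - t)) ?_ ?_
    · simpa using (EE_deriv ha).continuousAt
    · exact ContinuousAt.div (by fun_prop) (by fun_prop) (by norm_num)
  have h2 := h.tendsto
  simp only [sub_zero, div_one] at h2
  exact h2.mono_left nhdsWithin_le_nhds

lemma E2_left {a : ℝ} (ha : 0 < a) :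
    Tendsto (fun t => EE (a * t / (1 - t))) (𝓝[<] 1) (𝓝 0) := by
  refine EE_tendsto.comp ?_
  have h : Tendsto (fun t : ℝ => a * t) (𝓝[<] 1) (𝓝 (a * 1)) :=
    ((continuous_const.mul continuous_id).tendsto (1:ℝ)).mono_left nhdsWithin_le_nhds
  exact h.pos_mul_atTop (by simpa using ha) tendsto_inv_left

lemma E3_deriv {a t : ℝ} (ha : 0 < a) (ht : t ∈ Ioo (0:ℝ) 1) :
    HasDerivAt (fun t => EE (a / (1 - t))) (-(Real.exp (-(a / (1 - t))) / (1 - t))) t := by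
  obtain ⟨h0, h1⟩ := ht
  have hs : 0 < 1 - t := by linarith
  have d0 : HasDerivAt (fun t : ℝ => 1 - t) (-1) t := by
    simpa using (hasDerivAt_id t).const_sub 1
  have d : HasDerivAt (fun t : ℝ => a / (1 - t)) _ t := (hasDerivAt_const t a).div d0 hs.ne'
  refine ((EE_deriv (x := a / (1 - t)) (by positivity)).comp t d).congr_deriv ?_
  field_simp
  ring

lemma E2_deriv {a t : ℝ} (ha : 0 < a) (ht : t ∈ Ioo (0:ℝ) 1) :
    HasDerivAt (fun t => EE (a * t / (1 - t)))
      (-(Real.exp (-(a * t / (1 - t))) / (t * (1 - t)))) t := by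
  obtain ⟨h0, h1⟩ := ht
  have hs : 0 < 1 - t := by linarith
  have d0 : HasDerivAt (fun t : ℝ => 1 - t) (-1) t := by
    simpa using (hasDerivAt_id t).const_sub 1
  have d1 : HasDerivAt (fun t : ℝ => a * t) a t := by
    simpa using (hasDerivAt_id t).const_mul a
  have d : HasDerivAt (fun t : ℝ => a * t / (1 - t)) _ t := d1.div d0 hs.ne'
  refine ((EE_deriv (x := a * t / (1 - t)) (by positivity)).comp t d).congr_deriv ?_
  field_simp
  ring

lemma E1_deriv {a t : ℝ} (ha : 0 < a) (ht : t ∈ Ioo (0:ℝ) 1) :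
    HasDerivAt (fun t => EE (a * t)) (-(Real.exp (-(a * t)) / t)) t := by
  obtain ⟨h0, h1⟩ := ht
  have d1 : HasDerivAt (fun t : ℝ => a * t) a t := by
    simpa using (hasDerivAt_id t).const_mul a
  refine ((EE_deriv (x := a * t) (by positivity)).comp t d1).congr_deriv ?_
  field_simp

lemma T4 {a : ℝ} (ha : 0 < a) :
    ∫ t in (0:ℝ)..1, Real.exp (-(a / (1 - t))) / (1 - t) = EE a := by
  have := integral_eq_sub_of_hasDerivAt_of_tendsto (f := fun t => -EE (a / (1 - t)))
    (f' := fun t => Real.exp (-(a / (1 - t))) / (1 - t)) (zero_lt_one (α := ℝ))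
    (fun t ht => ((E3_deriv ha ht).neg).congr_deriv (neg_neg _)) (fourth_int ha)
    (E3_right ha).neg (E3_left ha).neg
  rw [this]; ring

lemma VD_integral {a : ℝ} (ha : 0 < a) :
    ∫ t in (0:ℝ)..1, VD a t = (-(Real.exp (-a) * KK a) + (Real.exp a - 1) * EE a) / a := by
  unfold VD
  have hn : IntervalIntegrable
      (fun t => -((Real.exp (-a * t) - Real.exp (-a)) / (1 - t))) volume 0 1 := (third_int ha).neg
  rw [intervalIntegral.integral_div, intervalIntegral.integral_add hn
    ((fourth_int ha).const_mul _), intervalIntegral.integral_neg, T3 ha,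
    intervalIntegral.integral_const_mul, T4 ha]

lemma T2_bound {a t : ℝ} (ha : 0 < a) (ht : t ∈ Ioo (0:ℝ) 1) :
    |(Real.exp (-a * t) - Real.exp (-a * t / (1 - t))) / t| ≤ a + 2 := by
  obtain ⟨h0, h1⟩ := ht
  have hs : 0 < 1 - t := by linarith
  have hat : 0 < a * t := by positivity
  have hle : -a * t / (1 - t) ≤ -a * t := by
    rw [div_le_iff₀ hs]; nlinarith
  have h2 := Real.exp_le_exp.2 hle
  rw [abs_of_nonneg (div_nonneg (by linarith) h0.le), div_le_iff₀ h0]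
  have h5 : Real.exp (-a * t) ≤ 1 := Real.exp_le_one_iff.2 (by nlinarith)
  rcases le_total t (1/2) with h | h
  · have h3 := Real.add_one_le_exp (-a * t / (1 - t) - (- a * t))
    have h4 : Real.exp (-a * t) * Real.exp (-a * t / (1 - t) - (- a * t))
        = Real.exp (-a * t / (1 - t)) := by
      rw [← Real.exp_add]; congr 1; ring
    have h6 : -a * t / (1 - t) - (- a * t) ≥ - (a * t) := by
      have : -(2 * (a * t)) ≤ -a * t / (1 - t) := by
        rw [le_div_iff₀ hs]; nlinarith
      linarith
    nlinarith [Real.exp_pos (-a * t)]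
  · have := Real.exp_pos (-a * t / (1 - t))
    nlinarith

lemma T2_int {a : ℝ} (ha : 0 < a) : IntervalIntegrable
    (fun t => (Real.exp (-a * t) - Real.exp (-a * t / (1 - t))) / t) volume 0 1 := by
  refine bint zero_le_one ?_ fun _ ht => T2_bound ha ht
  have : ContinuousOn (fun t : ℝ => -a * t / (1 - t)) (Ioo 0 1) :=
    ContinuousOn.div (by fun_prop) (by fun_prop) fun t ht => (sub_pos.2 ht.2).ne'
  exact ContinuousOn.div (by fun_prop) (by fun_prop) fun t ht => ht.1.ne'

lemma E12_right {a : ℝ} (ha : 0 < a) :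
    Tendsto (fun t => EE (a * t) - EE (a * t / (1 - t))) (𝓝[>] 0) (𝓝 0) := by
  have h : Tendsto (fun t : ℝ => t / (1 - t)) (𝓝[>] 0) (𝓝 0) := by
    have h : ContinuousAt (fun t : ℝ => t / (1 - t)) 0 :=
      ContinuousAt.div (by fun_prop) (by fun_prop) (by norm_num)
    have h2 := h.tendsto
    simp only [sub_zero, div_one] at h2
    exact h2.mono_left nhdsWithin_le_nhds
  have hev : ∀ᶠ t : ℝ in 𝓝[>] 0, t ∈ Ioo (0:ℝ) 1 := Ioo_mem_nhdsGT one_pos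
  refine tendsto_of_tendsto_of_tendsto_of_le_of_le' tendsto_const_nhds h ?_ ?_
  · filter_upwards [hev] with t ht
    have hs := sub_pos.2 ht.2
    have h0 := ht.1
    refine EE_diff_nonneg (mul_pos ha ht.1) ?_
    rw [le_div_iff₀ hs]; nlinarith [mul_pos ha h0]
  · filter_upwards [hev] with t ht
    have hs := sub_pos.2 ht.2
    have h0 := ht.1
    have hat := mul_pos ha h0
    have hle : a * t ≤ a * t / (1 - t) := by
      rw [le_div_iff₀ hs]; nlinarith
    refine (EE_diff_le hat hle).trans ?_
    have e : (a * t / (1 - t) - a * t) * (Real.exp (-(a * t)) / (a * t))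
        = t / (1 - t) * Real.exp (-(a * t)) := by
      field_simp
      ring
    rw [e]
    have h3 : Real.exp (-(a * t)) ≤ 1 := Real.exp_le_one_iff.2 (by linarith)
    exact mul_le_of_le_one_right (by positivity) h3

lemma T2 {a : ℝ} (ha : 0 < a) :
    ∫ t in (0:ℝ)..1, (Real.exp (-a * t) - Real.exp (-a * t / (1 - t))) / t
      = (Real.exp a - 1) * EE a := by
  have hl : Tendsto (fun t => EE (a * t)) (𝓝[<] 1) (𝓝 (EE a)) := by
    have h : ContinuousAt (fun t : ℝ => EE (a * t)) 1 := by
      refine ContinuousAt.comp (g := EE) (f := fun t : ℝ => a * t) ?_ (by fun_prop)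
      simpa using (EE_deriv ha).continuousAt
    have h2 := h.tendsto
    simp only [mul_one] at h2
    exact h2.mono_left nhdsWithin_le_nhds
  have := integral_eq_sub_of_hasDerivAt_of_tendsto
    (f := fun t => -(EE (a * t) - EE (a * t / (1 - t))) - Real.exp a * EE (a / (1 - t)))
    (f' := fun t => (Real.exp (-a * t) - Real.exp (-a * t / (1 - t))) / t)
    (zero_lt_one (α := ℝ))
    (fun t ht => by
      refine (((E1_deriv ha ht).sub (E2_deriv ha ht)).neg.sub
        ((E3_deriv ha ht).const_mul (Real.exp a))).congr_deriv ?_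
      have hs := sub_pos.2 ht.2
      have h0 := ht.1
      have e : -a * t / (1 - t) = -(a * t / (1 - t)) := by ring
      rw [e, exp_split ht.2, neg_mul]
      field_simp
      ring) (T2_int ha)
    ((E12_right ha).neg.sub ((E3_right ha).const_mul _))
    ((hl.sub (E2_left ha)).neg.sub ((E3_left ha).const_mul _))
  rw [this]; ring

noncomputable def GG (a : ℝ) : ℝ := ∫ t in (0:ℝ)..1, VV a t

lemma VD_bound {a t : ℝ} (ha : 0 < a) (ht : t ∈ Ioo (0:ℝ) 1) :
    |VD a t| ≤ (a + (Real.exp a - 1) * (1 / a)) / a := by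
  have h3 := third_bound ha ht
  have h4 := fourth_bound ha ht
  have h1 : 0 ≤ Real.exp a - 1 := by linarith [Real.add_one_le_exp a]
  rw [VD, abs_div, abs_of_pos ha]
  gcongr
  refine (abs_add_le _ _).trans ?_
  rw [abs_neg, abs_mul, abs_of_nonneg h1]
  gcongr

lemma GG_deriv {a : ℝ} (ha : 0 < a) :
    HasDerivAt GG ((-(Real.exp (-a) * KK a) + (Real.exp a - 1) * EE a) / a) a := by
  rw [← VD_integral ha]
  have hpos : ∀ x ∈ Ioo (a / 2) (2 * a), 0 < x := fun x hx => by linarith [hx.1]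
  have hn : Ioo (a / 2) (2 * a) ∈ 𝓝 a := Ioo_mem_nhds (by linarith) (by linarith)
  refine (hasDerivAt_integral_of_dominated_loc_of_deriv_le (F := VV) (F' := VD)
    (bound := fun _ => (2 * a + (Real.exp (2 * a) - 1) * (1 / (a / 2))) / (a / 2))
    hn ?_ (VV_int ha) ?_ ?_ (by simp) ?_).2
  · filter_upwards [hn] with x hx
    exact meas_of_cont zero_le_one (VV_cont (hpos x hx))
  · refine meas_of_cont zero_le_one ?_
    exact (((third_cont a).neg).add (continuousOn_const.mul (fourth_cont a))).div_const _
  · refine ae_Ioo zero_le_one fun t ht x hx => ?_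
    refine (VD_bound (hpos x hx) ht).trans ?_
    have h1 : 0 ≤ Real.exp (2 * a) - 1 := by linarith [Real.add_one_le_exp (2 * a)]
    have h0 := hpos x hx
    have := hx.1
    have := hx.2
    gcongr
  · exact ae_Ioo zero_le_one fun t ht x hx => VV_deriv (hpos x hx) ht

lemma GG_tendsto : Tendsto GG atTop (𝓝 0) := by
  have : Tendsto GG atTop (𝓝 (∫ t in (0:ℝ)..1, (0:ℝ))) := by
    refine tendsto_integral_filter_of_dominated_convergence (F := VV) (fun _ => 2) ?_ ?_ (by simp) ?_
    · filter_upwards [eventually_gt_atTop 0] with a ha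
      exact meas_of_cont zero_le_one (VV_cont ha)
    · filter_upwards [eventually_gt_atTop 0] with a ha
      exact ae_Ioo zero_le_one fun t ht => VV_bound ha ht
    · refine ae_Ioo zero_le_one fun t ht => ?_
      have h : Tendsto (fun a : ℝ => Real.exp (-(a * t)) / t) atTop (𝓝 (0 / t)) :=
        (Real.tendsto_exp_neg_atTop_nhds_zero.comp (tendsto_id.atTop_mul_const ht.1)).div_const t
      rw [zero_div] at h
      refine squeeze_zero_norm' ?_ h
      filter_upwards [eventually_gt_atTop 0] with a ha
      exact VV_bound1 ha ht
  simpa using this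

lemma EK_tendsto : Tendsto (fun a => EE a * KK a) atTop (𝓝 0) := by
  refine tendsto_of_tendsto_of_tendsto_of_le_of_le' tendsto_const_nhds
    tendsto_inv_atTop_zero ?_ ?_
  · filter_upwards [eventually_gt_atTop 0] with a ha
    exact mul_nonneg (EE_nonneg ha) (KK_bound ha).1
  · filter_upwards [eventually_gt_atTop 0] with a ha
    have h1 : EE a * KK a ≤ Real.exp (-a) / a * Real.exp a :=
      mul_le_mul (EE_le ha) (KK_bound ha).2 (KK_bound ha).1 (by positivity)
    refine h1.trans_eq ?_
    rw [Real.exp_neg]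
    field_simp

lemma GG_eq {c : ℝ} (hc : 0 < c) : GG c = EE c * KK c := by
  have hd : ∀ a : ℝ, 0 < a → HasDerivAt (fun a => GG a - EE a * KK a) 0 a := by
    intro a ha
    refine ((GG_deriv ha).sub ((EE_deriv ha).mul (KK_deriv ha))).congr_deriv ?_
    field_simp
    ring
  have hconst : ∀ a : ℝ, 0 < a → GG a - EE a * KK a = GG c - EE c * KK c := by
    intro a ha
    exact isOpen_Ioi.is_const_of_deriv_eq_zero (s := Ioi (0:ℝ))
      (f := fun a => GG a - EE a * KK a) isPreconnected_Ioi
      (fun x hx => (hd x hx).differentiableAt.differentiableWithinAt)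
      (fun x hx => (hd x hx).deriv) ha hc
  have h1 : Tendsto (fun a => GG a - EE a * KK a) atTop (𝓝 (0 - 0)) :=
    GG_tendsto.sub EK_tendsto
  have h2 : Tendsto (fun a => GG a - EE a * KK a) atTop (𝓝 (GG c - EE c * KK c)) := by
    refine tendsto_const_nhds.congr' ?_
    filter_upwards [eventually_gt_atTop 0] with a ha using (hconst a ha).symm
  have := tendsto_nhds_unique h1 h2
  linarith

lemma winRate_eq {c t : ℝ} (hc : 0 < c) (ht : t ∈ Ioo (0:ℝ) 1) :
    winRate c t = (Real.exp (-c * t) - Real.exp (-c * t / (1 - t))) / t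
      + (Real.exp (-c * t) - Real.exp (-c)) / (1 - t) - c * VV c t := by
  obtain ⟨h0, h1⟩ := ht
  have hs : 0 < 1 - t := by linarith
  rw [winRate, Ifun_eq hc (by positivity), Ifun_eq (by positivity) (by positivity), VV]
  field_simp
  ring

lemma main_eq {c : ℝ} (hc : 0 < c) (hK : KK c = 1) :
    (∫ t in (0:ℝ)..1, winRate c t) = Real.exp (-c) + (Real.exp c - c - 1) * EE c := by
  have : (∫ t in (0:ℝ)..1, winRate c t) = ∫ t in (0:ℝ)..1,
      ((Real.exp (-c * t) - Real.exp (-c * t / (1 - t))) / t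
      + (Real.exp (-c * t) - Real.exp (-c)) / (1 - t) - c * VV c t) :=
    integral_congr_ae (ae_Ioo zero_le_one fun t ht => winRate_eq hc ht)
  rw [this, intervalIntegral.integral_sub ((T2_int hc).add (third_int hc))
    ((VV_int hc).const_mul c), intervalIntegral.integral_add (T2_int hc) (third_int hc),
    T2 hc, T3 hc, intervalIntegral.integral_const_mul]
  have := GG_eq hc
  rw [GG] at this
  rw [this, hK]
  ring

end helpers
/-- `∫₀¹ w(t) dt = e^{−c} + (e^c − c − 1)·∫₁^∞ e^{−cx}/x dx` (Samuels' formula). -/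
theorem stmt_12 (c : ℝ) (hc : 0 < c)
    (hceq : (∫ x in (0:ℝ)..c, (Real.exp x - 1) / x) = 1) :
    (∫ t in (0:ℝ)..1, winRate c t) =
      Real.exp (-c) + (Real.exp c - c - 1) * ∫ x in Set.Ioi (1:ℝ), Real.exp (-c * x) / x := by
  rw [EE_scale hc]
  exact main_eq hc hceq
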